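/- Let M, N ≥ 1 and let ρ be a positive semidefinite complex matrix on ℂ^M ⊗ ℂ^N. Then for every real α with -1 ≤ α ≤ 2, the matrix Tr(ρ)·𝟙_{MN} + α·ρ is separable. -/

import Mathlib

open Matrix Kronecker
open scoped ComplexOrder

/-- A Hermitian matrix on ℂ^M ⊗ ℂ^N is separable if it is a finite sum of Kronecker
products of positive semidefinite matrices. -/
def IsSeparableMat {M N : ℕ} (σ : Matrix (Fin M × Fin N) (Fin M × Fin N) ℂ) : Prop :=
  ∃ (k : ℕ) (A : Fin k → Matrix (Fin M) (Fin M) ℂ) (B : Fin k → Matrix (Fin N) (Fin N) ℂ),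
    (∀ i, (A i).PosSemidef) ∧ (∀ i, (B i).PosSemidef) ∧ σ = ∑ i, A i ⊗ₖ B i

namespace IsSeparableMat

variable {M N : ℕ}

theorem of_fintype {ι : Type*} [Fintype ι] (A : ι → Matrix (Fin M) (Fin M) ℂ)
    (B : ι → Matrix (Fin N) (Fin N) ℂ) (hA : ∀ i, (A i).PosSemidef)
    (hB : ∀ i, (B i).PosSemidef) : IsSeparableMat (∑ i, A i ⊗ₖ B i) :=
  ⟨Fintype.card ι, fun i => A ((Fintype.equivFin ι).symm i),
    fun i => B ((Fintype.equivFin ι).symm i), fun _ => hA _, fun _ => hB _,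
    ((Fintype.equivFin ι).symm.sum_comp fun i => A i ⊗ₖ B i).symm⟩

theorem kronecker {A : Matrix (Fin M) (Fin M) ℂ} {B : Matrix (Fin N) (Fin N) ℂ}
    (hA : A.PosSemidef) (hB : B.PosSemidef) : IsSeparableMat (A ⊗ₖ B) := by
  simpa using of_fintype (fun _ : Unit => A) (fun _ => B) (fun _ => hA) fun _ => hB

theorem zero : IsSeparableMat (0 : Matrix (Fin M × Fin N) (Fin M × Fin N) ℂ) := by
  simpa using kronecker (PosSemidef.zero (n := Fin M) (R := ℂ))
    (PosSemidef.zero (n := Fin N) (R := ℂ))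

theorem add {σ τ : Matrix (Fin M × Fin N) (Fin M × Fin N) ℂ} (hσ : IsSeparableMat σ)
    (hτ : IsSeparableMat τ) : IsSeparableMat (σ + τ) := by
  obtain ⟨k, A, B, hA, hB, rfl⟩ := hσ
  obtain ⟨l, C, D, hC, hD, rfl⟩ := hτ
  simpa using of_fintype (Sum.elim A C) (Sum.elim B D) (by rintro (i | i) <;> simp [hA, hC])
    (by rintro (i | i) <;> simp [hB, hD])

theorem sum {ι : Type*} (s : Finset ι) {σ : ι → Matrix (Fin M × Fin N) (Fin M × Fin N) ℂ}
    (h : ∀ i ∈ s, IsSeparableMat (σ i)) : IsSeparableMat (∑ i ∈ s, σ i) :=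
  Finset.sum_induction σ IsSeparableMat (fun _ _ => add) zero h

theorem smul {σ : Matrix (Fin M × Fin N) (Fin M × Fin N) ℂ} (hσ : IsSeparableMat σ)
    {c : ℝ} (hc : 0 ≤ c) : IsSeparableMat ((c : ℂ) • σ) := by
  obtain ⟨k, A, B, hA, hB, rfl⟩ := hσ
  refine ⟨k, fun i => (c : ℂ) • A i, B, fun i => (hA i).smul (by exact_mod_cast hc), hB, ?_⟩
  simp [Finset.smul_sum, smul_kronecker]

end IsSeparableMat

theorem sum_stdAddChar_phases {ι : Type*} [Fintype ι] [DecidableEq ι] (i j k l : ι) :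
    ∑ g : ι → ZMod 3, ZMod.stdAddChar (g i - g j - g k + g l) =
      if (i = j ∧ k = l) ∨ (i = k ∧ j = l) then (Fintype.card (ι → ZMod 3) : ℂ) else 0 := by
  split_ifs with h
  · rw [Finset.sum_congr rfl (g := fun _ => (1 : ℂ))]
    · simp
    · rintro g -
      rcases h with ⟨rfl, rfl⟩ | ⟨rfl, rfl⟩ <;> simp
  · obtain ⟨c, hc⟩ : ∃ c : ι → ZMod 3, c i - c j - c k + c l ≠ 0 := by
      have h2 : (1 : ZMod 3) + 1 ≠ 0 := by decide
      by_cases hij : i = j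
      · refine ⟨Pi.single l 1, ?_⟩
        have : k ≠ l := fun e => h (.inl ⟨hij, e⟩)
        simp [hij, Pi.single_apply, this]
      · by_cases hik : i = k
        · refine ⟨Pi.single l 1, ?_⟩
          have : j ≠ l := fun e => h (.inr ⟨hik, e⟩)
          simp [hik, Pi.single_apply, this]
        · refine ⟨Pi.single i 1, ?_⟩
          by_cases hil : l = i <;> simp [Ne.symm hij, Ne.symm hik, hil, h2]
    have hχ : ZMod.stdAddChar (c i - c j - c k + c l) ≠ (1 : ℂ) := fun e =>
      hc (ZMod.injective_stdAddChar (e.trans (AddChar.map_zero_eq_one _).symm))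
    have hs := Equiv.sum_comp (Equiv.addRight c)
      fun g : ι → ZMod 3 => (ZMod.stdAddChar (g i - g j - g k + g l) : ℂ)
    have hshift (g : ι → ZMod 3) : (ZMod.stdAddChar (Equiv.addRight c g i -
        Equiv.addRight c g j - Equiv.addRight c g k + Equiv.addRight c g l) : ℂ) =
        ZMod.stdAddChar (c i - c j - c k + c l) *
          ZMod.stdAddChar (g i - g j - g k + g l) := by
      rw [← AddChar.map_add_eq_mul]
      congr 1
      simp only [Equiv.coe_addRight, Pi.add_apply]
      ring
    simp only [hshift, ← Finset.mul_sum] at hs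
    by_contra h0
    exact hχ (mul_right_cancel₀ h0 (hs.trans (one_mul _).symm))

section PhaseAverage

variable {M N : ℕ} {ι : Type*} [Fintype ι]

theorem phase_sum_apply {n : Type*} (χ : AddChar (ZMod 3) ℂ) (g : ι → ZMod 3)
    (u : ι → n → ℂ) (m m' : n) :
    vecMulVec (∑ i, χ (g i) • u i) (star (∑ i, χ (g i) • u i)) m m' =
      ∑ i, ∑ k, χ (g i - g k) * (u i m * star (u k m')) := by
  simp only [vecMulVec_apply, Pi.star_apply, Finset.sum_apply, Pi.smul_apply, star_sum,
    Finset.sum_mul_sum, smul_eq_mul, star_mul', sub_eq_add_neg, AddChar.map_add_eq_mul,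
    AddChar.map_neg_eq_conj]
  refine Finset.sum_congr rfl fun i _ => Finset.sum_congr rfl fun k _ => ?_
  simp only [RCLike.star_def]
  ring

/-- Averaging the product vectors `(∑ i, ω i • u i) ⊗ (∑ i, star (ω i) • v i)` over independent
cube roots of unity `ω i`. -/
theorem isSeparableMat_phase_average [DecidableEq ι] (u : ι → Fin M → ℂ) (v : ι → Fin N → ℂ) :
    IsSeparableMat
      ((∑ i, ∑ k, vecMulVec (u i) (star (u k)) ⊗ₖ vecMulVec (v i) (star (v k))) +
        ∑ i, ∑ j, if i = j then 0 else
          vecMulVec (u i) (star (u i)) ⊗ₖ vecMulVec (v j) (star (v j))) := by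
  have key := (IsSeparableMat.of_fintype
    (fun g : ι → ZMod 3 => vecMulVec (∑ i, ZMod.stdAddChar (g i) • u i)
      (star (∑ i, ZMod.stdAddChar (g i) • u i)))
    (fun g => vecMulVec (∑ i, ZMod.stdAddChar ((-g) i) • v i)
      (star (∑ i, ZMod.stdAddChar ((-g) i) • v i)))
    (fun _ => posSemidef_vecMulVec_self_star _)
    (fun _ => posSemidef_vecMulVec_self_star _)).smul
    (c := (Fintype.card (ι → ZMod 3) : ℝ)⁻¹) (by positivity)
  convert key using 1
  have hcard : (Fintype.card (ι → ZMod 3) : ℂ) ≠ 0 := by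
    exact_mod_cast Fintype.card_ne_zero
  ext ⟨m, n⟩ ⟨m', n'⟩
  simp only [Matrix.add_apply, Matrix.smul_apply, Matrix.sum_apply, kroneckerMap_apply,
    phase_sum_apply, Finset.sum_mul_sum]
  have hswap : ∑ g : ι → ZMod 3, ∑ i, ∑ j, ∑ k, ∑ l,
      (ZMod.stdAddChar (g i - g k) * (u i m * star (u k m'))) *
        (ZMod.stdAddChar ((-g) j - (-g) l) * (v j n * star (v l n'))) =
      ∑ i, ∑ j, ∑ k, ∑ l, (if (i = j ∧ k = l) ∨ (i = k ∧ j = l)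
        then (Fintype.card (ι → ZMod 3) : ℂ) else 0) *
        (u i m * star (u k m') * (v j n * star (v l n'))) := by
    simp only [← sum_stdAddChar_phases, Finset.sum_mul]
    rw [Finset.sum_comm]
    refine Finset.sum_congr rfl fun i _ => ?_
    rw [Finset.sum_comm]
    refine Finset.sum_congr rfl fun j _ => ?_
    rw [Finset.sum_comm]
    refine Finset.sum_congr rfl fun k _ => ?_
    rw [Finset.sum_comm]
    refine Finset.sum_congr rfl fun l _ => Finset.sum_congr rfl fun g _ => ?_
    rw [show g i - g j - g k + g l = (g i - g k) + ((-g) j - (-g) l) by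
      simp only [Pi.neg_apply]; ring, AddChar.map_add_eq_mul]
    ring
  have hif (i j k l : ι) : (if (i = j ∧ k = l) ∨ (i = k ∧ j = l)
        then (Fintype.card (ι → ZMod 3) : ℂ) else 0) =
      Fintype.card (ι → ZMod 3) * ((if i = j then if k = l then 1 else 0 else 0) +
        if i = k then if j = l then if i = j then 0 else 1 else 0 else 0) := by
    by_cases hij : i = j
    · subst hij
      by_cases hkl : k = l
      · subst hkl
        simp
      · by_cases hik : i = k
        · subst hik
          simp [hkl]
        · simp [hkl, hik]
    · by_cases hik : i = k
      · subst hik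
        simp [hij]
      · simp [hij, hik]
  rw [hswap]
  simp only [hif, mul_assoc, ← Finset.mul_sum, smul_eq_mul]
  push_cast
  rw [inv_mul_cancel_left₀ hcard]
  simp only [add_mul, Finset.sum_add_distrib, ite_mul, zero_mul, one_mul]
  congr 1
  · simp [Finset.sum_ite_irrel, vecMulVec_apply, mul_assoc]
  · simp only [Finset.sum_ite_irrel, Finset.sum_const_zero, Finset.sum_ite_eq, Finset.mem_univ,
      if_true]
    refine Finset.sum_congr rfl fun i _ => Finset.sum_congr rfl fun j _ => ?_
    split_ifs <;> simp [vecMulVec_apply, mul_assoc]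

end PhaseAverage
theorem Matrix.PosSemidef.exists_eq_sum_vecMulVec {n : Type*} [Fintype n] {ρ : Matrix n n ℂ}
    (hρ : ρ.PosSemidef) : ∃ v : n → n → ℂ, ρ = ∑ k, vecMulVec (v k) (star (v k)) := by
  classical
  obtain ⟨B, rfl⟩ : ∃ B : Matrix n n ℂ, ρ = star B * B := by
    open scoped MatrixOrder in
    exact CStarAlgebra.nonneg_iff_eq_star_mul_self.mp hρ.nonneg
  refine ⟨fun k i => star (B k i), ?_⟩
  ext i j
  simp [Matrix.mul_apply, Matrix.sum_apply, vecMulVec_apply, star_eq_conjTranspose]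

theorem exists_schmidt_decomposition {m n : Type*} [Fintype m] [Fintype n] [DecidableEq m]
    [DecidableEq n] (ψ : m × n → ℂ) :
    ∃ (a : n → ℝ) (e : n → m → ℂ) (g : n → n → ℂ), (∀ i, 0 ≤ a i) ∧
      (∀ p, ψ p = ∑ i, (a i : ℂ) * (e i p.1 * g i p.2)) ∧
      (1 - ∑ i, vecMulVec (e i) (star (e i))).PosSemidef ∧
      ∑ i, vecMulVec (g i) (star (g i)) = 1 ∧
      (vecMulVec ψ (star ψ)).trace = ((∑ i, a i ^ 2 : ℝ) : ℂ) := by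
  set A : Matrix m n ℂ := Matrix.of fun i j => ψ (i, j) with hA
  have hH : (Aᴴ * A).PosSemidef := posSemidef_conjTranspose_mul_self A
  set l := hH.isHermitian.eigenvalues with hl
  have hl0 : ∀ i, 0 ≤ l i := hH.eigenvalues_nonneg
  set U : Matrix n n ℂ := (hH.isHermitian.eigenvectorUnitary : Matrix n n ℂ) with hU
  have hUU : U * Uᴴ = 1 := (Unitary.mem_iff.mp hH.isHermitian.eigenvectorUnitary.2).2
  set W := A * U with hW
  have hWW : Wᴴ * W = diagonal fun i => (l i : ℂ) := by
    have h := hH.isHermitian.conjStarAlgAut_star_eigenvectorUnitary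
    rw [Unitary.conjStarAlgAut_star_apply] at h
    rw [hW, conjTranspose_mul, Matrix.mul_assoc, ← Matrix.mul_assoc Aᴴ, ← Matrix.mul_assoc]
    exact h
  have hW0 (k : n) (hk : l k = 0) (i : m) : W i k = 0 := by
    have h := congrFun (congrFun hWW k) k
    rw [diagonal_apply_eq, hk] at h
    have h' : star (fun i => W i k) ⬝ᵥ (fun i => W i k) = 0 := by
      simpa [Matrix.mul_apply, dotProduct] using h
    exact congrFun (dotProduct_star_self_eq_zero.mp h') i
  have hs (k : n) : ((√(l k) : ℝ) : ℂ) * (√(l k) : ℝ) = l k := by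
    rw [← Complex.ofReal_mul, Real.mul_self_sqrt (hl0 k)]
  set d : n → ℂ := fun k => ((√(l k))⁻¹ : ℝ) with hd
  set C := W * diagonal d with hC
  have hdW (i : m) (k : n) : W i k * d k * (√(l k) : ℝ) = W i k := by
    by_cases hk : l k = 0
    · simp [hW0 k hk]
    · have : ((√(l k) : ℝ) : ℂ) ≠ 0 := by
        simpa [Real.sqrt_eq_zero (hl0 k)] using hk
      simp [hd, this]
  have hCC : C * (Cᴴ * C) = C := by
    have hCd : Cᴴ * C = diagonal fun k => d k * l k * d k := by
      rw [hC, conjTranspose_mul, diagonal_conjTranspose, Matrix.mul_assoc,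
        ← Matrix.mul_assoc Wᴴ, hWW, diagonal_mul_diagonal, diagonal_mul_diagonal]
      congr 1
      ext k
      simp [hd, mul_assoc]
    rw [hCd]
    ext i k
    rw [hC, mul_diagonal, mul_diagonal, ← hs k]
    calc W i k * d k * (d k * ((√(l k) : ℝ) * (√(l k) : ℝ)) * d k)
        = W i k * d k * (√(l k) : ℝ) * d k * (√(l k) : ℝ) * d k := by ring
      _ = W i k * d k := by rw [hdW, hdW]
  have hsum : ∑ k, vecMulVec (fun i => C i k) (star fun i => C i k) = C * Cᴴ := by
    ext i j
    simp [Matrix.sum_apply, vecMulVec_apply, Matrix.mul_apply]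
  refine ⟨fun k => √(l k), fun k i => C i k, fun k j => star (U j k),
    fun _ => Real.sqrt_nonneg _, ?_, ?_, ?_, ?_⟩
  · rintro ⟨i, j⟩
    have hWU : A = W * Uᴴ := by rw [hW, Matrix.mul_assoc, hUU, Matrix.mul_one]
    have h := congrFun (congrFun hWU i) j
    rw [Matrix.mul_apply] at h
    refine h.trans (Finset.sum_congr rfl fun k _ => ?_)
    change W i k * star (U j k) = ((√(l k) : ℝ) : ℂ) * (C i k * star (U j k))
    rw [hC, mul_diagonal, ← mul_assoc, mul_comm _ (W i k * d k), hdW]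
  · rw [hsum]
    have h : 1 - C * Cᴴ = (1 - C * Cᴴ)ᴴ * (1 - C * Cᴴ) := by
      have hp : C * Cᴴ * (C * Cᴴ) = C * Cᴴ := by
        rw [Matrix.mul_assoc, ← Matrix.mul_assoc Cᴴ, ← Matrix.mul_assoc C, hCC]
      simp only [conjTranspose_sub, conjTranspose_one, conjTranspose_mul,
        conjTranspose_conjTranspose, Matrix.sub_mul, Matrix.mul_sub, Matrix.one_mul,
        Matrix.mul_one, hp]
      abel
    rw [h]
    exact posSemidef_conjTranspose_mul_self _
  · have hUt := congrArg Matrix.transpose hUU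
    rw [transpose_one] at hUt
    rw [← hUt]
    ext i j
    simp [Matrix.sum_apply, vecMulVec_apply, Matrix.mul_apply, mul_comm]
  · have ht : (Aᴴ * A).trace = (vecMulVec ψ (star ψ)).trace := by
      simp [Matrix.trace, Matrix.mul_apply, vecMulVec_apply, Fintype.sum_prod_type, hA, mul_comm]
      exact Finset.sum_comm
    rw [← ht, hH.isHermitian.trace_eq_sum_eigenvalues]
    push_cast
    refine Finset.sum_congr rfl fun k _ => ?_
    rw [sq, hs k]
    rfl

theorem sum_sum_ite_eq_zero {ι V : Type*} [Fintype ι] [DecidableEq ι] [AddCommGroup V]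
    (x : ι → ι → V) :
    (∑ i, ∑ j, if i = j then 0 else x i j) = ∑ i, ∑ j, x i j - ∑ i, x i i := by
  rw [eq_sub_iff_add_eq, ← Finset.sum_add_distrib]
  refine Finset.sum_congr rfl fun i _ => ?_
  have h (j : ι) : (if i = j then 0 else x i j) = x i j - if i = j then x i j else 0 := by
    split_ifs <;> simp
  simp [h]

section Schmidt

variable {M N : ℕ}

theorem vecMulVec_smul_kronecker_vecMulVec_smul {m n : Type*} (x y : m → ℂ) (z w : n → ℂ)
    (b c b' c' : ℝ) :
    vecMulVec ((b : ℂ) • x) (star ((c : ℂ) • y)) ⊗ₖ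
        vecMulVec ((b' : ℂ) • z) (star ((c' : ℂ) • w)) =
      ((b * b' * (c * c') : ℝ) : ℂ) • (vecMulVec x (star y) ⊗ₖ vecMulVec z (star w)) := by
  ext ⟨i, j⟩ ⟨k, l⟩
  simp [vecMulVec_apply]
  ring

theorem isSeparableMat_schmidt_add {ι : Type*} [Fintype ι] [DecidableEq ι] (a : ι → ℝ)
    (ha : ∀ i, 0 ≤ a i) (e : ι → Fin M → ℂ) (g : ι → Fin N → ℂ) :
    IsSeparableMat
      ((∑ i, ∑ k, ((a i * a k : ℝ) : ℂ) •
          (vecMulVec (e i) (star (e k)) ⊗ₖ vecMulVec (g i) (star (g k)))) +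
        ∑ i, ∑ j, if i = j then 0 else ((a i * a j : ℝ) : ℂ) •
          (vecMulVec (e i) (star (e i)) ⊗ₖ vecMulVec (g j) (star (g j)))) := by
  have hs (i : ι) : √(a i) * √(a i) = a i := Real.mul_self_sqrt (ha i)
  have hs' (i j : ι) : √(a i) * √(a j) * (√(a i) * √(a j)) = a i * a j := by
    rw [mul_mul_mul_comm, hs, hs]
  simpa only [vecMulVec_smul_kronecker_vecMulVec_smul, hs, hs'] using
    isSeparableMat_phase_average (fun i => ((√(a i) : ℝ) : ℂ) • e i)
      (fun i => ((√(a i) : ℝ) : ℂ) • g i)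

theorem isSeparableMat_pair {b c : ℝ} (hb : 0 ≤ b) (hc : 0 ≤ c) (x y : Fin M → ℂ)
    (z w : Fin N → ℂ) :
    IsSeparableMat
      (((c ^ 2 : ℝ) : ℂ) • (vecMulVec x (star x) ⊗ₖ vecMulVec z (star z)) +
        ((b ^ 2 : ℝ) : ℂ) • (vecMulVec y (star y) ⊗ₖ vecMulVec w (star w)) -
        ((b * c : ℝ) : ℂ) • (vecMulVec x (star y) ⊗ₖ vecMulVec z (star w)) -
        ((b * c : ℝ) : ℂ) • (vecMulVec y (star x) ⊗ₖ vecMulVec w (star z)) +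
        ((b * c : ℝ) : ℂ) • (vecMulVec x (star x) ⊗ₖ vecMulVec w (star w)) +
        ((b * c : ℝ) : ℂ) • (vecMulVec y (star y) ⊗ₖ vecMulVec z (star z))) := by
  have hb' : √b * √b = b := Real.mul_self_sqrt hb
  have hc' : √c * √c = c := Real.mul_self_sqrt hc
  have h := isSeparableMat_phase_average
    ![((√c : ℝ) : ℂ) • x, ((-√b : ℝ) : ℂ) • y] ![((√c : ℝ) : ℂ) • z, ((√b : ℝ) : ℂ) • w]
  simp only [Fin.sum_univ_two, Matrix.cons_val_zero, Matrix.cons_val_one,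
    vecMulVec_smul_kronecker_vecMulVec_smul, if_true, zero_ne_one, one_ne_zero, if_false] at h
  have h1 : √c * √c * (√c * √c) = c ^ 2 := by rw [hc', sq]
  have h2 : -√b * √b * (-√b * √b) = b ^ 2 := by rw [neg_mul, hb', neg_mul_neg, sq]
  have h3 : √c * √c * (-√b * √b) = -(b * c) := by rw [neg_mul, hb', hc']; ring
  have h4 : -√b * √b * (√c * √c) = -(b * c) := by rw [neg_mul, hb', hc']; ring
  have h5 : √c * √b * (√c * √b) = b * c := by rw [mul_mul_mul_comm, hb', hc', mul_comm]
  have h6 : -√b * √c * (-√b * √c) = b * c := by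
    rw [mul_mul_mul_comm, neg_mul_neg, hb', hc']
  rw [h1, h2, h3, h4, h5, h6] at h
  convert h using 1
  push_cast
  module

theorem isSeparableMat_rank_one_extremes (ψ : Fin M × Fin N → ℂ) :
    IsSeparableMat ((vecMulVec ψ (star ψ)).trace •
      (1 : Matrix (Fin M × Fin N) (Fin M × Fin N) ℂ) + (2 : ℂ) • vecMulVec ψ (star ψ)) ∧
    IsSeparableMat ((vecMulVec ψ (star ψ)).trace •
      (1 : Matrix (Fin M × Fin N) (Fin M × Fin N) ℂ) - vecMulVec ψ (star ψ)) := by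
  obtain ⟨a, e, g, ha, hψ, hQ, hG, htr⟩ := exists_schmidt_decomposition ψ
  set τ : ℝ := ∑ i, a i ^ 2 with hτ
  have hτ0 : 0 ≤ τ := Finset.sum_nonneg fun i _ => sq_nonneg _
  set F : Fin N → Fin N → Matrix (Fin M × Fin N) (Fin M × Fin N) ℂ := fun i j =>
    vecMulVec (e i) (star (e i)) ⊗ₖ vecMulVec (g j) (star (g j)) with hF
  set T : Fin N → Fin N → Matrix (Fin M × Fin N) (Fin M × Fin N) ℂ := fun i k =>
    vecMulVec (e i) (star (e k)) ⊗ₖ vecMulVec (g i) (star (g k)) with hT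
  set R : Matrix (Fin M × Fin N) (Fin M × Fin N) ℂ :=
    (1 - ∑ i, vecMulVec (e i) (star (e i))) ⊗ₖ (1 : Matrix (Fin N) (Fin N) ℂ) with hR
  have hFsep (i j) : IsSeparableMat (F i j) :=
    .kronecker (posSemidef_vecMulVec_self_star _) (posSemidef_vecMulVec_self_star _)
  have hRsep : IsSeparableMat ((τ : ℂ) • R) := (IsSeparableMat.kronecker hQ .one).smul hτ0
  have hone : (1 : Matrix (Fin M × Fin N) (Fin M × Fin N) ℂ) = R + ∑ i, ∑ j, F i j := by
    have h : ∑ i, ∑ j, F i j =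
        (∑ i, vecMulVec (e i) (star (e i))) ⊗ₖ (1 : Matrix (Fin N) (Fin N) ℂ) := by
      rw [← hG]
      ext ⟨i, j⟩ ⟨k, l⟩
      simp [hF, Matrix.sum_apply, Finset.sum_mul_sum]
    rw [h, hR, ← add_kronecker, sub_add_cancel, one_kronecker_one]
  have hψT : vecMulVec ψ (star ψ) = ∑ i, ∑ k, ((a i * a k : ℝ) : ℂ) • T i k := by
    ext p q
    simp only [vecMulVec_apply, Pi.star_apply, hψ, star_sum, Finset.sum_mul_sum,
      Matrix.sum_apply, hT, Matrix.smul_apply, kroneckerMap_apply]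
    refine Finset.sum_congr rfl fun i _ => Finset.sum_congr rfl fun k _ => ?_
    simp
    ring
  have hle {i j : Fin N} (hij : i ≠ j) : 2 * (a i * a j) ≤ τ := by
    have h := Finset.sum_le_sum_of_subset_of_nonneg (Finset.subset_univ {i, j})
      (f := fun i => a i ^ 2) fun i _ _ => sq_nonneg _
    rw [Finset.sum_pair hij] at h
    nlinarith [sq_nonneg (a i - a j)]
  have hFsum (c : ℝ) (hc : c ≤ 2) : IsSeparableMat
      (∑ i, ∑ j, if i = j then 0 else ((τ - c * (a i * a j) : ℝ) : ℂ) • F i j) := by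
    refine .sum _ fun i _ => .sum _ fun j _ => ?_
    split_ifs with hij
    · exact .zero
    · refine (hFsep i j).smul ?_
      nlinarith [hle hij, mul_nonneg (ha i) (ha j)]
  constructor
  · have hdiag : IsSeparableMat (∑ i, (τ : ℂ) • F i i) :=
      .sum _ fun i _ => (hFsep i i).smul hτ0
    have hadd := (isSeparableMat_schmidt_add a ha e g).smul (zero_le_two (α := ℝ))
    convert ((hRsep.add (hFsum 2 le_rfl)).add hdiag).add hadd using 1
    rw [htr, hψT, hone]
    change _ = _ + ((2 : ℝ) : ℂ) • (∑ i, ∑ k, ((a i * a k : ℝ) : ℂ) • T i k +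
      ∑ i, ∑ j, if i = j then 0 else ((a i * a j : ℝ) : ℂ) • F i j)
    simp only [sum_sum_ite_eq_zero, Complex.ofReal_sub, sub_smul, Finset.sum_sub_distrib,
      ← Finset.smul_sum, Complex.ofReal_mul, Complex.ofReal_ofNat, mul_smul (2 : ℂ)]
    module
  · have hpair : IsSeparableMat (∑ i, ∑ k, if i = k then 0 else
        (((a k ^ 2 : ℝ) : ℂ) • T i i + ((a i ^ 2 : ℝ) : ℂ) • T k k -
          ((a i * a k : ℝ) : ℂ) • T i k - ((a i * a k : ℝ) : ℂ) • T k i +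
          ((a i * a k : ℝ) : ℂ) • F i k + ((a i * a k : ℝ) : ℂ) • F k i)) := by
      refine .sum _ fun i _ => .sum _ fun k _ => ?_
      split_ifs
      · exact .zero
      · exact isSeparableMat_pair (ha i) (ha k) _ _ _ _
    convert (hRsep.add (hFsum 1 one_le_two)).add
      (hpair.smul (c := 1 / 2) (by norm_num)) using 1
    have hTF (i) : T i i = F i i := rfl
    have h1 : ∑ i, ∑ k, ((a k ^ 2 : ℝ) : ℂ) • F i i = (τ : ℂ) • ∑ i, F i i := by
      simp only [← Finset.sum_smul, Finset.smul_sum, hτ, Complex.ofReal_sum]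
    have h2 : ∑ i, ∑ k, ((a i ^ 2 : ℝ) : ℂ) • F k k = (τ : ℂ) • ∑ i, F i i := by
      rw [Finset.sum_comm, h1]
    have h3 : ∑ i, ∑ k, ((a i * a k : ℝ) : ℂ) • T k i =
        ∑ i, ∑ k, ((a i * a k : ℝ) : ℂ) • T i k := by
      rw [Finset.sum_comm]
      simp only [mul_comm]
    have h4 : ∑ i, ∑ k, ((a i * a k : ℝ) : ℂ) • F k i =
        ∑ i, ∑ k, ((a i * a k : ℝ) : ℂ) • F i k := by
      rw [Finset.sum_comm]
      simp only [mul_comm]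
    rw [htr, hψT, hone]
    simp only [sum_sum_ite_eq_zero, hTF, Complex.ofReal_sub, sub_smul, Finset.sum_sub_distrib,
      Finset.sum_add_distrib, h1, h2, h3, h4, one_mul, ← sq]
    simp only [← Finset.smul_sum]
    push_cast
    module

end Schmidt

theorem stmt0 {M N : ℕ} (hM : 1 ≤ M) (hN : 1 ≤ N)
    (ρ : Matrix (Fin M × Fin N) (Fin M × Fin N) ℂ) (hρ : ρ.PosSemidef)
    (α : ℝ) (hα1 : -1 ≤ α) (hα2 : α ≤ 2) :
    IsSeparableMat
      (ρ.trace • (1 : Matrix (Fin M × Fin N) (Fin M × Fin N) ℂ) + (α : ℂ) • ρ) := by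
  obtain ⟨v, hv⟩ := hρ.exists_eq_sum_vecMulVec
  have h := IsSeparableMat.sum Finset.univ fun k _ =>
    ((isSeparableMat_rank_one_extremes (v k)).1.smul (c := (α + 1) / 3) (by linarith)).add
      ((isSeparableMat_rank_one_extremes (v k)).2.smul (c := (2 - α) / 3) (by linarith))
  convert h using 1
  rw [hv, trace_sum, Finset.sum_smul, Finset.smul_sum, ← Finset.sum_add_distrib]
  refine Finset.sum_congr rfl fun k _ => ?_
  push_cast
  module
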